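/- Let L be a finite lattice with ⊥ and ⊤. Define a relation Step on Set L by: Step A B if and only if there exist u ∈ A and v ∈ A with u ≤ v, u ≠ ⊥, v ≠ ⊤, such that (for all x, y ∈ A with x ≤ v and y ≤ v, u ≤ x ⊔ y implies u ≤ x or u ≤ y), (for all x, y ∈ A with u ≤ x and u ≤ y, x ⊓ y ≤ v implies x ≤ v or y ≤ v), and B = A \ Set.Icc u v. Then there exists a set C : Set L with Relation.ReflTransGen Step Set.univ C such that for every A : Set L with Relation.ReflTransGen Step Set.univ A, one has Relation.ReflTransGen Step A C (in particular C ⊆ A). Hence the family of sets obtainable from L by iteratively removing dismantling intervals has a unique smallest element, the DI-core of L. -/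

import Mathlib

/-- One dismantling step: `Step A B` holds when `B` is obtained from `A` by
removing a dismantling interval of the suborder `A`. -/
def Step {L : Type*} [Lattice L] [BoundedOrder L] (A B : Set L) : Prop :=
  ∃ u ∈ A, ∃ v ∈ A, u ≤ v ∧ u ≠ ⊥ ∧ v ≠ ⊤ ∧
    (∀ x ∈ A, ∀ y ∈ A, x ≤ v → y ≤ v → u ≤ x ⊔ y → u ≤ x ∨ u ≤ y) ∧
    (∀ x ∈ A, ∀ y ∈ A, u ≤ x → u ≤ y → x ⊓ y ≤ v → x ≤ v ∨ y ≤ v) ∧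
    B = A \ Set.Icc u v

theorem InfClosed.exists_isLeast {L : Type*} [SemilatticeInf L] [Finite L] {S : Set L}
    (hS : InfClosed S) (hne : S.Nonempty) : ∃ m, IsLeast S m := by
  obtain ⟨m, hm⟩ := S.toFinite.exists_minimal hne
  exact ⟨m, hm.prop, fun x hx =>
    (hm.le_of_le (hS hm.prop hx) inf_le_left).trans inf_le_right⟩

theorem SupClosed.exists_isGreatest {L : Type*} [SemilatticeSup L] [Finite L] {S : Set L}
    (hS : SupClosed S) (hne : S.Nonempty) : ∃ m, IsGreatest S m := by
  obtain ⟨m, hm⟩ := S.toFinite.exists_maximal hne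
  exact ⟨m, hm.prop, fun x hx =>
    le_sup_right.trans (hm.le_of_ge (hS hm.prop hx) le_sup_left)⟩

section Step

variable {L : Type*} [Lattice L] [BoundedOrder L]

theorem Step.subset {A B : Set L} (h : Step A B) : B ⊆ A := by
  obtain ⟨u, -, v, -, -, -, -, -, -, rfl⟩ := h
  exact Set.sdiff_subset

theorem Step.subset_of_reflTransGen {A B : Set L} (h : Relation.ReflTransGen Step A B) :
    B ⊆ A := by
  induction h with
  | refl => exact subset_rfl
  | tail _ hstep ih => exact hstep.subset.trans ih

theorem Step.isSublattice {A B : Set L} (h : Step A B) (hA : IsSublattice A) :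
    IsSublattice B := by
  obtain ⟨u, -, v, -, -, -, -, hsup, hinf, rfl⟩ := h
  constructor
  · rintro x ⟨hx, hxu⟩ y ⟨hy, hyu⟩
    refine ⟨hA.supClosed hx hy, fun ⟨h₁, h₂⟩ => ?_⟩
    have hxv := le_sup_left.trans h₂
    have hyv := le_sup_right.trans h₂
    exact (hsup x hx y hy hxv hyv h₁).elim (fun h => hxu ⟨h, hxv⟩) (fun h => hyu ⟨h, hyv⟩)
  · rintro x ⟨hx, hxu⟩ y ⟨hy, hyu⟩
    refine ⟨hA.infClosed hx hy, fun ⟨h₁, h₂⟩ => ?_⟩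
    have hux := h₁.trans inf_le_left
    have huy := h₁.trans inf_le_right
    exact (hinf x hx y hy hux huy h₂).elim (fun h => hxu ⟨hux, h⟩) (fun h => hyu ⟨huy, h⟩)

/-- After one dismantling step, what is left of another dismantling interval is either empty or
again a dismantling interval. -/
theorem Step.reflGen_inter [Finite L] {A B C : Set L} (hA : IsSublattice A) (hB : Step A B)
    (hC : Step A C) : Relation.ReflGen Step B (B ∩ C) := by
  obtain ⟨u, hu, v, hv, huv, hu0, hv1, hsup, hinf, rfl⟩ := hB
  obtain ⟨s, hs, t, ht, hst, hs0, ht1, hsup', hinf', rfl⟩ := hC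
  by_cases hsB : s ∈ Set.Icc u v <;> by_cases htB : t ∈ Set.Icc u v
  · have : A \ Set.Icc u v ∩ (A \ Set.Icc s t) = A \ Set.Icc u v := by
      have := Set.Icc_subset_Icc hsB.1 htB.2
      ext x
      simp only [Set.mem_inter_iff, Set.mem_sdiff]
      exact ⟨fun h => h.1, fun h => ⟨h, h.1, fun hx => h.2 (this hx)⟩⟩
    rw [this]
  · have htv : ¬ t ≤ v := fun h => htB ⟨hsB.1.trans hst, h⟩
    obtain ⟨w, ⟨hwA, hsw, hwt, hwv⟩, hw⟩ :=
      InfClosed.exists_isLeast (S := {x | x ∈ A ∧ s ≤ x ∧ x ≤ t ∧ ¬ x ≤ v})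
        (fun x hx y hy => ⟨hA.infClosed hx.1 hy.1, le_inf hx.2.1 hy.2.1,
          inf_le_left.trans hx.2.2.1, fun h =>
            (hinf x hx.1 y hy.1 (hsB.1.trans hx.2.1) (hsB.1.trans hy.2.1) h).elim
              hx.2.2.2 hy.2.2.2⟩)
        ⟨t, ht, hst, le_rfl, htv⟩
    have key : ∀ x ∈ A \ Set.Icc u v, s ≤ x → x ≤ t → w ≤ x := fun x hx hsx hxt =>
      hw ⟨hx.1, hsx, hxt, fun h => hx.2 ⟨hsB.1.trans hsx, h⟩⟩
    refine .single ⟨w, ⟨hwA, fun h => hwv h.2⟩, t, ⟨ht, htB⟩, hwt,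
      fun h => hs0 (le_bot_iff.1 (h ▸ hsw)), ht1, ?_, ?_, ?_⟩
    · intro x hx y hy hxt hyt hwxy
      exact (hsup' x hx.1 y hy.1 hxt hyt (hsw.trans hwxy)).imp
        (fun h => key x hx h hxt) (fun h => key y hy h hyt)
    · intro x hx y hy hwx hwy h
      exact hinf' x hx.1 y hy.1 (hsw.trans hwx) (hsw.trans hwy) h
    · ext x
      exact ⟨fun h => ⟨h.1, fun hx => h.2.2 ⟨hsw.trans hx.1, hx.2⟩⟩,
        fun h => ⟨h.1, h.1.1, fun hx => h.2 ⟨key x h.1 hx.1 hx.2, hx.2⟩⟩⟩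
  · have hus : ¬ u ≤ s := fun h => hsB ⟨h, hst.trans htB.2⟩
    obtain ⟨w, ⟨hwA, hsw, hwt, hwu⟩, hw⟩ :=
      SupClosed.exists_isGreatest (S := {x | x ∈ A ∧ s ≤ x ∧ x ≤ t ∧ ¬ u ≤ x})
        (fun x hx y hy => ⟨hA.supClosed hx.1 hy.1, hx.2.1.trans le_sup_left,
          sup_le hx.2.2.1 hy.2.2.1, fun h =>
            (hsup x hx.1 y hy.1 (hx.2.2.1.trans htB.2) (hy.2.2.1.trans htB.2) h).elim
              hx.2.2.2 hy.2.2.2⟩)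
        ⟨s, hs, le_rfl, hst, hus⟩
    have key : ∀ x ∈ A \ Set.Icc u v, s ≤ x → x ≤ t → x ≤ w := fun x hx hsx hxt =>
      hw ⟨hx.1, hsx, hxt, fun h => hx.2 ⟨h, hxt.trans htB.2⟩⟩
    refine .single ⟨s, ⟨hs, hsB⟩, w, ⟨hwA, fun h => hwu h.1⟩, hsw, hs0,
      fun h => ht1 (top_le_iff.1 (h ▸ hwt)), ?_, ?_, ?_⟩
    · intro x hx y hy hxw hyw h
      exact hsup' x hx.1 y hy.1 (hxw.trans hwt) (hyw.trans hwt) h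
    · intro x hx y hy hsx hsy hxyw
      exact (hinf' x hx.1 y hy.1 hsx hsy (hxyw.trans hwt)).imp
        (fun h => key x hx hsx h) (fun h => key y hy hsy h)
    · ext x
      exact ⟨fun h => ⟨h.1, fun hx => h.2.2 ⟨hx.1, hx.2.trans hwt⟩⟩,
        fun h => ⟨h.1, h.1.1, fun hx => h.2 ⟨hx.1, key x h.1 hx.1 hx.2⟩⟩⟩
  · refine .single ⟨s, ⟨hs, hsB⟩, t, ⟨ht, htB⟩, hst, hs0, ht1,
      fun x hx y hy => hsup' x hx.1 y hy.1, fun x hx y hy => hinf' x hx.1 y hy.1, ?_⟩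
    ext x
    exact ⟨fun h => ⟨h.1, h.2.2⟩, fun h => ⟨h.1, h.1.1, h.2⟩⟩

/-- Iterated dismantling of a finite sublattice is confluent. -/
theorem Step.join_of_reflTransGen [Finite L] {A B C : Set L} (hA : IsSublattice A)
    (hB : Relation.ReflTransGen Step A B) (hC : Relation.ReflTransGen Step A C) :
    Relation.Join (Relation.ReflTransGen Step) B C := by
  let r : Set L → Set L → Prop := fun A B => IsSublattice A ∧ Step A B
  have lift : ∀ {B}, Relation.ReflTransGen Step A B →
      Relation.ReflTransGen r A B ∧ IsSublattice B := by
    intro B h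
    induction h with
    | refl => exact ⟨.refl, hA⟩
    | tail _ hstep ih => exact ⟨ih.1.tail ⟨ih.2, hstep⟩, hstep.isSublattice ih.2⟩
  have diamond : ∀ {A B C}, r A B → r A C → Relation.ReflGen r B (B ∩ C) := by
    rintro A B C ⟨hA, hB⟩ ⟨-, hC⟩
    have h := hB.reflGen_inter hA hC
    rw [Relation.reflGen_iff] at h ⊢
    exact h.imp id fun h => ⟨hB.isSublattice hA, h⟩
  obtain ⟨D, hBD, hCD⟩ := Relation.church_rosser
    (fun A B C hB hC => ⟨B ∩ C, diamond hB hC,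
      Set.inter_comm C B ▸ (diamond hC hB).to_reflTransGen⟩) (lift hB).1 (lift hC).1
  exact ⟨D, hBD.lift id fun _ _ h => h.2, hCD.lift id fun _ _ h => h.2⟩

end Step

theorem unique_DI_core {L : Type*} [Lattice L] [BoundedOrder L] [Fintype L] :
    ∃ C : Set L, Relation.ReflTransGen Step Set.univ C ∧
      ∀ A : Set L, Relation.ReflTransGen Step Set.univ A →
        Relation.ReflTransGen Step A C := by
  obtain ⟨C, hC⟩ := (Set.toFinite {A : Set L | Relation.ReflTransGen Step Set.univ A}).exists_minimal
    ⟨Set.univ, .refl⟩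
  refine ⟨C, hC.prop, fun A hA => ?_⟩
  obtain ⟨D, hAD, hCD⟩ := Step.join_of_reflTransGen isSublattice_univ hA hC.prop
  have hDC : D = C := hC.eq_of_subset (hA.trans hAD) (Step.subset_of_reflTransGen hCD)
  exact hDC ▸ hAD
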